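/- arXiv:0811.4203 — 7 statements merged into one kernel-verified Lean document; each statement's English description precedes it below -/
import Mathlib

section
/- Let λ > 0 and let f : [0,1] → ℝ be continuous. Define u(x) = ∫₀¹ G^λ(x,y) f(y) dy. Then u(0) = u(1) = 0, u is twice differentiable on (0,1), and λ·u(x) − u''(x) = f(x) for every x ∈ (0,1). That is, G^λ is the kernel of the Dirichlet resolvent (λI − Δ)^{-1} on the unit interval, where Δu = u''. -/
open Real MeasureTheory Set

/-- The Dirichlet resolvent kernel `G^λ` on the unit interval. -/
noncomputable def dirKernel (l x y : ℝ) : ℝ :=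
  if x ≤ y then
    Real.sinh (Real.sqrt l * x) * Real.sinh (Real.sqrt l * (1 - y)) /
      (Real.sqrt l * Real.sinh (Real.sqrt l))
  else
    Real.sinh (Real.sqrt l * y) * Real.sinh (Real.sqrt l * (1 - x)) /
      (Real.sqrt l * Real.sinh (Real.sqrt l))

lemma intervalIntegrable_of_continuousOn_Icc {g : ℝ → ℝ} {a b c d : ℝ}
    (hg : ContinuousOn g (Icc a b)) (hc : c ∈ Icc a b) (hd : d ∈ Icc a b) :
    IntervalIntegrable g volume c d :=
  (hg.mono (uIcc_subset_Icc hc hd)).intervalIntegrable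

lemma hasDerivAt_integral_of_continuousOn_Icc {g : ℝ → ℝ} {a b x : ℝ}
    (hg : ContinuousOn g (Icc a b)) (hx : x ∈ Ioo a b) :
    HasDerivAt (fun z => ∫ y in a..z, g y) (g x) x := by
  have hab : a ≤ b := (hx.1.trans hx.2).le
  exact intervalIntegral.integral_hasDerivAt_right
    (intervalIntegrable_of_continuousOn_Icc hg (left_mem_Icc.2 hab) (Ioo_subset_Icc_self hx))
    ((hg.mono Ioo_subset_Icc_self).stronglyMeasurableAtFilter isOpen_Ioo x hx)
    (hg.continuousAt (Icc_mem_nhds hx.1 hx.2))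

lemma hasDerivAt_integral_left_of_continuousOn_Icc {g : ℝ → ℝ} {a b x : ℝ}
    (hg : ContinuousOn g (Icc a b)) (hx : x ∈ Ioo a b) :
    HasDerivAt (fun z => ∫ y in z..b, g y) (-g x) x := by
  have hab : a ≤ b := (hx.1.trans hx.2).le
  exact intervalIntegral.integral_hasDerivAt_left
    (intervalIntegrable_of_continuousOn_Icc hg (Ioo_subset_Icc_self hx) (right_mem_Icc.2 hab))
    ((hg.mono Ioo_subset_Icc_self).stronglyMeasurableAtFilter isOpen_Ioo x hx)
    (hg.continuousAt (Icc_mem_nhds hx.1 hx.2))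

/-- Splitting the integral against the kernel at the diagonal. -/
lemma integral_dirKernel_mul (l : ℝ) {f : ℝ → ℝ} (hf : ContinuousOn f (Icc 0 1)) {x : ℝ}
    (hx : x ∈ Icc (0 : ℝ) 1) :
    ∫ y in (0 : ℝ)..1, dirKernel l x y * f y =
      (sinh (√l * (1 - x)) * (∫ y in (0 : ℝ)..x, sinh (√l * y) * f y) +
        sinh (√l * x) * ∫ y in x..1, sinh (√l * (1 - y)) * f y) / (√l * sinh (√l)) := by
  have h0 : (0 : ℝ) ∈ Icc (0 : ℝ) 1 := by simp
  have h1 : (1 : ℝ) ∈ Icc (0 : ℝ) 1 := by simp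
  have hleft : EqOn (fun y => dirKernel l x y * f y)
      (fun y => sinh (√l * (1 - x)) / (√l * sinh (√l)) * (sinh (√l * y) * f y)) (uIcc 0 x) := by
    intro y hy
    rw [uIcc_of_le hx.1] at hy
    simp only [dirKernel]
    split_ifs with h
    · obtain rfl : x = y := le_antisymm h hy.2
      ring
    · ring
  have hright : EqOn (fun y => dirKernel l x y * f y)
      (fun y => sinh (√l * x) / (√l * sinh (√l)) * (sinh (√l * (1 - y)) * f y)) (uIcc x 1) := by
    intro y hy
    rw [uIcc_of_le hx.2] at hy
    simp only [dirKernel, if_pos hy.1]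
    ring
  have cleft : ContinuousOn
      (fun y => sinh (√l * (1 - x)) / (√l * sinh (√l)) * (sinh (√l * y) * f y)) (Icc 0 1) := by
    fun_prop
  have cright : ContinuousOn
      (fun y => sinh (√l * x) / (√l * sinh (√l)) * (sinh (√l * (1 - y)) * f y)) (Icc 0 1) := by
    fun_prop
  rw [← intervalIntegral.integral_add_adjacent_intervals
      ((intervalIntegrable_of_continuousOn_Icc cleft h0 hx).congr (hleft.symm.mono uIoc_subset_uIcc))
      ((intervalIntegrable_of_continuousOn_Icc cright hx h1).congr (hright.symm.mono uIoc_subset_uIcc)),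
    intervalIntegral.integral_congr hleft, intervalIntegral.integral_congr hright,
    intervalIntegral.integral_const_mul, intervalIntegral.integral_const_mul]
  ring

/-- `G^λ` is the kernel of the Dirichlet resolvent `(λI − Δ)⁻¹` on `[0,1]`. -/
theorem dirichlet_resolvent_kernel_interval
    (l : ℝ) (hl : 0 < l) (f : ℝ → ℝ) (hf : ContinuousOn f (Set.Icc 0 1))
    (u : ℝ → ℝ) (hu : ∀ x : ℝ, u x = ∫ y in (0:ℝ)..1, dirKernel l x y * f y) :
    u 0 = 0 ∧ u 1 = 0 ∧
    ∃ u' u'' : ℝ → ℝ, ∀ x ∈ Set.Ioo (0:ℝ) 1,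
      HasDerivAt u (u' x) x ∧ HasDerivAt u' (u'' x) x ∧
      l * u x - u'' x = f x := by
  have hu_split : ∀ x ∈ Icc (0 : ℝ) 1, u x = _ :=
    fun x hx => (hu x).trans (integral_dirKernel_mul l hf hx)
  refine ⟨by simp [hu_split 0 (by simp)], by simp [hu_split 1 (by simp)],
    fun x => (-cosh (√l * (1 - x)) * (∫ y in (0 : ℝ)..x, sinh (√l * y) * f y) +
        cosh (√l * x) * ∫ y in x..1, sinh (√l * (1 - y)) * f y) / sinh (√l),
    fun x => l * u x - f x, fun x hx => ?_⟩
  have hs : 0 < √l := sqrt_pos.2 hl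
  have hS : sinh (√l) ≠ 0 := (sinh_pos_iff.2 hs).ne'
  have hsq : √l ^ 2 = l := sq_sqrt hl.le
  have hadd : sinh (√l) =
      sinh (√l * x) * cosh (√l * (1 - x)) + cosh (√l * x) * sinh (√l * (1 - x)) := by
    rw [← sinh_add]
    ring_nf
  have dA := hasDerivAt_integral_of_continuousOn_Icc
    (g := fun y => sinh (√l * y) * f y) (by fun_prop) hx
  have dB := hasDerivAt_integral_left_of_continuousOn_Icc
    (g := fun y => sinh (√l * (1 - y)) * f y) (by fun_prop) hx
  have dl : HasDerivAt (fun z => √l * z) (√l) x := by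
    simpa using (hasDerivAt_id x).const_mul (√l)
  have dr : HasDerivAt (fun z => √l * (1 - z)) (-√l) x := by
    simpa using ((hasDerivAt_id x).const_sub 1).const_mul (√l)
  refine ⟨?_, ?_, by ring⟩
  · have hev : u =ᶠ[nhds x] _ :=
      Filter.eventually_of_mem (Icc_mem_nhds hx.1 hx.2) hu_split
    refine HasDerivAt.congr_of_eventuallyEq ?_ hev
    refine (((dr.sinh.mul dA).add (dl.sinh.mul dB)).div_const _).congr_deriv ?_
    field_simp
    ring
  · refine (((dr.cosh.neg.mul dA).add (dl.cosh.mul dB)).div_const _).congr_deriv ?_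
    simp only [Pi.neg_apply]
    rw [hu_split x (Ioo_subset_Icc_self hx)]
    generalize (∫ y in (0 : ℝ)..x, sinh (√l * y) * f y) = A
    generalize (∫ y in x..1, sinh (√l * (1 - y)) * f y) = B
    rw [div_eq_iff hS]
    have hlu : ∀ T : ℝ, (l * (T / (√l * sinh (√l))) - f x) * sinh (√l) =
        √l * T - f x * sinh (√l) := by
      intro T
      nth_rewrite 1 [← hsq]
      field_simp
    rw [hlu]
    linear_combination f x * hadd
end

section
/- For every λ > 0 and all x, y ∈ [0,1], G^λ(x,y) = Σ_{m=0}^∞ Σ_{w ∈ {1,2}^m} 2^{−m} · Ψ^{λ/4^m}(F_w^{-1}x, F_w^{-1}y), where the series converges. -/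
open Real Set

/-- The fundamental solution `ψ^λ` on the unit interval. -/
noncomputable def psiFun (l x : ℝ) : ℝ :=
  if x ≤ 1/2 then Real.sinh (Real.sqrt l * x) / Real.sinh (Real.sqrt l / 2)
  else Real.sinh (Real.sqrt l * (1 - x)) / Real.sinh (Real.sqrt l / 2)

/-- `Ψ^λ(x,y)`. -/
noncomputable def PsiFun (l x y : ℝ) : ℝ :=
  (Real.sinh (Real.sqrt l / 2) / (2 * Real.sqrt l * Real.cosh (Real.sqrt l / 2))) *
    psiFun l x * psiFun l y

/-- Inverse of one branch: `F₁⁻¹(x) = 2x` (symbol `false`), `F₂⁻¹(x) = 2x − 1` (symbol `true`). -/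
noncomputable def FInv : Bool → ℝ → ℝ
  | false, x => 2 * x
  | true,  x => 2 * x - 1

/-- For the word `w = w₁…w_m` (head = `w₁`), `F_w = F_{w₁} ∘ ⋯ ∘ F_{w_m}`, so
`F_w⁻¹ = F_{w_m}⁻¹ ∘ ⋯ ∘ F_{w₁}⁻¹`. -/
noncomputable def FwInv : List Bool → ℝ → ℝ
  | [], x => x
  | b :: t, x => FwInv t (FInv b x)

/-- The summand `2^{-m}` coefficientless term: `Ψ^{λ/4^m}(F_w⁻¹x, F_w⁻¹y)`, by convention `0`
unless both `x` and `y` lie in `F_w([0,1])`, i.e. unless `F_w⁻¹x, F_w⁻¹y ∈ [0,1]`. -/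
noncomputable def PsiTerm (l : ℝ) (m : ℕ) (w : List Bool) (x y : ℝ) : ℝ :=
  if FwInv w x ∈ Set.Icc (0:ℝ) 1 ∧ FwInv w y ∈ Set.Icc (0:ℝ) 1 then
    PsiFun (l / 4 ^ m) (FwInv w x) (FwInv w y)
  else 0

/-- The Dirichlet resolvent kernel, extended by zero outside the open unit square. -/
noncomputable def dirKernelZero (l x y : ℝ) : ℝ :=
  if x ∈ Ioo (0 : ℝ) 1 ∧ y ∈ Ioo (0 : ℝ) 1 then dirKernel l x y else 0

/-- The contribution of the words of length `m` to the series. -/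
noncomputable def levelSum (l x y : ℝ) (m : ℕ) : ℝ :=
  ∑ w : Fin m → Bool, (1 / 2 ^ m : ℝ) * PsiTerm l m (List.ofFn w) x y

theorem dirKernel_comm (l x y : ℝ) : dirKernel l x y = dirKernel l y x := by
  unfold dirKernel
  rcases lt_trichotomy x y with h | rfl | h
  · rw [if_pos h.le, if_neg h.not_ge]
  · rfl
  · rw [if_neg h.not_ge, if_pos h.le]

theorem dirKernelZero_comm (l x y : ℝ) : dirKernelZero l x y = dirKernelZero l y x := by
  simp only [dirKernelZero, dirKernel_comm l x y, and_comm]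

theorem PsiFun_comm (l x y : ℝ) : PsiFun l x y = PsiFun l y x := by
  unfold PsiFun; ring

theorem psiFun_nonneg (l : ℝ) {x : ℝ} (hx : x ∈ Icc (0 : ℝ) 1) : 0 ≤ psiFun l x := by
  have h1 := hx.1
  have h2 : 0 ≤ 1 - x := sub_nonneg.2 hx.2
  unfold psiFun
  split_ifs
  · exact div_nonneg (sinh_nonneg_iff.2 (by positivity)) (sinh_nonneg_iff.2 (by positivity))
  · exact div_nonneg (sinh_nonneg_iff.2 (by positivity)) (sinh_nonneg_iff.2 (by positivity))

theorem PsiFun_nonneg (l : ℝ) {x y : ℝ} (hx : x ∈ Icc (0 : ℝ) 1) (hy : y ∈ Icc (0 : ℝ) 1) :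
    0 ≤ PsiFun l x y := by
  have h : 0 ≤ sinh (√l / 2) := sinh_nonneg_iff.2 (by positivity)
  have h1 := psiFun_nonneg l hx
  have h2 := psiFun_nonneg l hy
  unfold PsiFun
  positivity

theorem levelSum_nonneg (l x y : ℝ) (m : ℕ) : 0 ≤ levelSum l x y m := by
  refine Finset.sum_nonneg fun w _ => mul_nonneg (by positivity) ?_
  unfold PsiTerm
  split_ifs with h
  · exact PsiFun_nonneg _ h.1 h.2
  · exact le_rfl

theorem psiFun_zero (l : ℝ) : psiFun l 0 = 0 := by simp [psiFun]

theorem psiFun_one (l : ℝ) : psiFun l 1 = 0 := by norm_num [psiFun]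

theorem levelSum_zero (l x y : ℝ) :
    levelSum l x y 0 = if x ∈ Ioo (0 : ℝ) 1 ∧ y ∈ Ioo (0 : ℝ) 1 then PsiFun l x y else 0 := by
  have key {x : ℝ} (hx : x ∈ Icc (0 : ℝ) 1) (hx' : x ∉ Ioo (0 : ℝ) 1) : psiFun l x = 0 := by
    rcases eq_endpoints_or_mem_Ioo_of_mem_Icc hx with rfl | rfl | h
    · exact psiFun_zero l
    · exact psiFun_one l
    · exact absurd h hx'
  simp only [levelSum, PsiTerm, FwInv, List.ofFn_zero, pow_zero, div_one, one_mul,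
    Finset.univ_unique, Finset.sum_singleton]
  by_cases hI : x ∈ Ioo (0 : ℝ) 1 ∧ y ∈ Ioo (0 : ℝ) 1
  · rw [if_pos ⟨Ioo_subset_Icc_self hI.1, Ioo_subset_Icc_self hI.2⟩, if_pos hI]
  · rw [if_neg hI]
    split_ifs with h
    · rcases not_and_or.1 hI with h' | h'
      · simp [PsiFun, key h.1 h']
      · simp [PsiFun, key h.2 h']
    · rfl

theorem levelSum_succ (l x y : ℝ) (m : ℕ) :
    levelSum l x y (m + 1) = 1 / 2 * (levelSum (l / 4) (FInv false x) (FInv false y) m +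
      levelSum (l / 4) (FInv true x) (FInv true y) m) := by
  have h (b : Bool) (w : Fin m → Bool) :
      (1 / 2 ^ (m + 1) : ℝ) * PsiTerm l (m + 1) (List.ofFn (Fin.cons b w : Fin (m + 1) → Bool)) x y =
        1 / 2 * ((1 / 2 ^ m : ℝ) * PsiTerm (l / 4) m (List.ofFn w) (FInv b x) (FInv b y)) := by
    have h4 : l / 4 ^ (m + 1) = l / 4 / 4 ^ m := by rw [pow_succ']; field_simp
    simp only [PsiTerm, List.ofFn_cons, FwInv, h4]
    ring
  unfold levelSum
  rw [← (Fin.consEquiv fun _ : Fin (m + 1) => Bool).sum_comp, Fintype.sum_prod_type]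
  simp only [Fin.consEquiv, Equiv.coe_fn_mk, h, Fintype.sum_bool, ← Finset.mul_sum]
  ring

theorem sqrt_div_four (l : ℝ) : √(l / 4) = √l / 2 := by
  rw [sqrt_div' _ (by norm_num)]
  congr 1
  rw [show (4 : ℝ) = 2 ^ 2 by norm_num]
  exact sqrt_sq (by norm_num)

/-- Splitting the kernel at the midpoint, in the triangle `x ≤ y`. -/
theorem dirKernelZero_eq_of_le {l x y : ℝ} (hl : 0 < l) (hx : x ∈ Ioo (0 : ℝ) 1)
    (hy : y ∈ Ioo (0 : ℝ) 1) (hxy : x ≤ y) :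
    dirKernelZero l x y = PsiFun l x y +
      1 / 2 * (dirKernelZero (l / 4) (FInv false x) (FInv false y) +
        dirKernelZero (l / 4) (FInv true x) (FInv true y)) := by
  obtain ⟨hx0, hx1⟩ := hx
  obtain ⟨hy0, hy1⟩ := hy
  obtain ⟨t, ht, hlt⟩ : ∃ t : ℝ, 0 < t ∧ √l = 2 * t := ⟨√l / 2, by positivity, by ring⟩
  have ht4 : √(l / 4) = t := by rw [sqrt_div_four, hlt]; ring
  have hs : 0 < sinh t := sinh_pos_iff.2 ht
  have hc : 0 < cosh t := cosh_pos t
  have hsq := cosh_sq t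
  have h2 : 2 * t / 2 = t := by ring
  simp only [dirKernelZero, mem_Ioo, FInv, dirKernel, PsiFun, psiFun, hlt, ht4, h2]
  rw [if_pos ⟨⟨hx0, hx1⟩, hy0, hy1⟩, if_pos hxy, sinh_two_mul t]
  rcases lt_or_ge y (1 / 2) with hy2 | hy2
  · rw [if_pos (hxy.trans hy2.le), if_pos hy2.le,
      if_pos ⟨⟨by linarith, by linarith⟩, by linarith, by linarith⟩, if_pos (by linarith),
      if_neg (fun h => by linarith [h.1.1])]
    rw [show 2 * t * (1 - y) = t + (t - 2 * t * y) by ring,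
      show t * (2 * x) = 2 * t * x by ring, show t * (1 - 2 * y) = t - 2 * t * y by ring,
      sinh_add, sinh_sub, cosh_sub]
    field_simp
    linear_combination sinh (2 * t * x) * sinh (2 * t * y) * hsq
  rcases le_or_gt x (1 / 2) with hx2 | hx2
  · have hψ : (if y ≤ 1 / 2 then sinh (2 * t * y) / sinh t else sinh (2 * t * (1 - y)) / sinh t) =
        sinh (2 * t * (1 - y)) / sinh t := by
      split_ifs with h
      · obtain rfl : y = 1 / 2 := le_antisymm h hy2
        norm_num
      · rfl
    have hf : ¬((0 < 2 * x ∧ 2 * x < 1) ∧ 0 < 2 * y ∧ 2 * y < 1) := fun h => by linarith [h.2.2]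
    have hr : ¬((0 < 2 * x - 1 ∧ 2 * x - 1 < 1) ∧ 0 < 2 * y - 1 ∧ 2 * y - 1 < 1) :=
      fun h => by linarith [h.1.1]
    rw [hψ, if_pos hx2, if_neg hf, if_neg hr]
    field_simp
    ring
  · rw [if_neg hx2.not_ge, if_neg (by linarith), if_neg (fun h => by linarith [h.1.2]),
      if_pos ⟨⟨by linarith, by linarith⟩, by linarith, by linarith⟩, if_pos (by linarith)]
    rw [show 2 * t * x = t + (t - 2 * t * (1 - x)) by ring,
      show t * (2 * x - 1) = t - 2 * t * (1 - x) by ring,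
      show t * (1 - (2 * y - 1)) = 2 * t * (1 - y) by ring,
      sinh_add, sinh_sub, cosh_sub]
    field_simp
    linear_combination sinh (2 * t * (1 - x)) * sinh (2 * t * (1 - y)) * hsq

theorem FInv_mem_Ioo {b : Bool} {x : ℝ} (h : FInv b x ∈ Ioo (0 : ℝ) 1) : x ∈ Ioo (0 : ℝ) 1 := by
  obtain ⟨h0, h1⟩ := h
  cases b <;> simp only [FInv] at h0 h1 <;> constructor <;> linarith

theorem dirKernelZero_eq {l : ℝ} (hl : 0 < l) (x y : ℝ) :
    dirKernelZero l x y = levelSum l x y 0 +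
      1 / 2 * (dirKernelZero (l / 4) (FInv false x) (FInv false y) +
        dirKernelZero (l / 4) (FInv true x) (FInv true y)) := by
  rw [levelSum_zero]
  by_cases hI : x ∈ Ioo (0 : ℝ) 1 ∧ y ∈ Ioo (0 : ℝ) 1
  · rw [if_pos hI]
    rcases le_total x y with h | h
    · exact dirKernelZero_eq_of_le hl hI.1 hI.2 h
    · simp only [dirKernelZero_comm _ _ y, dirKernelZero_comm _ _ (FInv _ y), PsiFun_comm l x y]
      exact dirKernelZero_eq_of_le hl hI.2 hI.1 h
  · have hF (b : Bool) : ¬(FInv b x ∈ Ioo (0 : ℝ) 1 ∧ FInv b y ∈ Ioo (0 : ℝ) 1) :=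
      fun h => hI ⟨FInv_mem_Ioo h.1, FInv_mem_Ioo h.2⟩
    simp only [dirKernelZero, if_neg hI, if_neg (hF _)]
    norm_num

theorem sinh_le_two_mul_cosh {b : ℝ} (hb : 0 ≤ b) : sinh b ≤ 2 * b * cosh b := by
  have h1 : 1 - 2 * b ≤ exp (-b) * exp (-b) := by
    rw [← exp_add]
    linarith [add_one_le_exp (-b + -b)]
  have h2 : exp b * exp (-b) = 1 := by rw [← exp_add]; simp
  have h3 : exp b * (1 - 2 * b) ≤ exp (-b) := by
    calc exp b * (1 - 2 * b) ≤ exp b * (exp (-b) * exp (-b)) := by gcongr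
      _ = exp (-b) := by rw [← mul_assoc, h2, one_mul]
  have h4 : 0 ≤ b * exp (-b) := by positivity
  rw [sinh_eq, cosh_eq]
  linarith

theorem abs_dirKernel_le {l x y : ℝ} (hl : 0 < l) (hx : x ∈ Icc (0 : ℝ) 1)
    (hy : y ∈ Icc (0 : ℝ) 1) : |dirKernel l x y| ≤ 2 := by
  wlog hxy : x ≤ y generalizing x y
  · rw [dirKernel_comm]
    exact this hy hx (le_of_not_ge hxy)
  have hs : 0 < √l := by positivity
  have hS : 0 < sinh √l := sinh_pos_iff.2 hs
  have ha : 0 ≤ √l * x := mul_nonneg hs.le hx.1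
  have hb : 0 ≤ √l * (1 - y) := mul_nonneg hs.le (sub_nonneg.2 hy.2)
  have hsa := sinh_nonneg_iff.2 ha
  have hsb := sinh_nonneg_iff.2 hb
  have hbs : √l * (1 - y) ≤ √l := mul_le_of_le_one_right hs.le (by linarith [hy.1])
  have hab : √l * x + √l * (1 - y) ≤ √l := by nlinarith
  rw [dirKernel, if_pos hxy, abs_of_nonneg (by positivity), div_le_iff₀ (by positivity)]
  have hadd : sinh (√l * x) * cosh (√l * (1 - y)) ≤ sinh √l := by
    have := sinh_le_sinh.2 hab
    rw [sinh_add] at this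
    linarith [mul_nonneg (cosh_pos (√l * x)).le hsb]
  calc sinh (√l * x) * sinh (√l * (1 - y))
      ≤ sinh (√l * x) * (2 * (√l * (1 - y)) * cosh (√l * (1 - y))) := by
        gcongr
        exact sinh_le_two_mul_cosh hb
    _ = 2 * (√l * (1 - y)) * (sinh (√l * x) * cosh (√l * (1 - y))) := by ring
    _ ≤ 2 * √l * sinh √l := by gcongr
    _ = 2 * (√l * sinh √l) := by ring

/-- The remainder after `N` levels vanishes off the open unit square and is `O(2⁻ᴺ)` on it. -/
theorem abs_dirKernelZero_sub_sum_le (N : ℕ) {l : ℝ} (hl : 0 < l) (x y : ℝ) :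
    |dirKernelZero l x y - ∑ m ∈ Finset.range N, levelSum l x y m| ≤
      if x ∈ Ioo (0 : ℝ) 1 ∧ y ∈ Ioo (0 : ℝ) 1 then 2 / 2 ^ N else 0 := by
  induction N generalizing l x y with
  | zero =>
    unfold dirKernelZero
    split_ifs with h
    · simpa using abs_dirKernel_le hl (Ioo_subset_Icc_self h.1) (Ioo_subset_Icc_self h.2)
    · simp
  | succ N ih =>
    have h0 := ih (l := l / 4) (by positivity) (FInv false x) (FInv false y)
    have h1 := ih (l := l / 4) (by positivity) (FInv true x) (FInv true y)
    have hrec : dirKernelZero l x y - ∑ m ∈ Finset.range (N + 1), levelSum l x y m =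
        1 / 2 * ((dirKernelZero (l / 4) (FInv false x) (FInv false y) -
            ∑ m ∈ Finset.range N, levelSum (l / 4) (FInv false x) (FInv false y) m) +
          (dirKernelZero (l / 4) (FInv true x) (FInv true y) -
            ∑ m ∈ Finset.range N, levelSum (l / 4) (FInv true x) (FInv true y) m)) := by
      rw [Finset.sum_range_succ', dirKernelZero_eq hl]
      simp only [levelSum_succ, ← Finset.mul_sum, Finset.sum_add_distrib]
      ring
    have hN : (2 : ℝ) / 2 ^ (N + 1) = 1 / 2 * (2 / 2 ^ N) := by rw [pow_succ]; field_simp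
    have hpos : (0 : ℝ) ≤ 2 / 2 ^ N := by positivity
    rw [hrec, abs_mul, abs_of_pos (by norm_num : (0 : ℝ) < 1 / 2), hN]
    refine (mul_le_mul_of_nonneg_left ((abs_add_le _ _).trans (add_le_add h0 h1))
      (by norm_num)).trans ?_
    by_cases hI : x ∈ Ioo (0 : ℝ) 1 ∧ y ∈ Ioo (0 : ℝ) 1
    · rw [if_pos hI]
      gcongr
      split_ifs with hf ht
      · have := hf.1.2
        have := ht.1.1
        simp only [FInv] at *
        linarith
      all_goals linarith
    · have hF (b : Bool) : ¬(FInv b x ∈ Ioo (0 : ℝ) 1 ∧ FInv b y ∈ Ioo (0 : ℝ) 1) :=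
        fun h => hI ⟨FInv_mem_Ioo h.1, FInv_mem_Ioo h.2⟩
      rw [if_neg hI, if_neg (hF _), if_neg (hF _)]
      norm_num

theorem dirKernelZero_eq_dirKernel (l : ℝ) {x y : ℝ} (hx : x ∈ Icc (0 : ℝ) 1)
    (hy : y ∈ Icc (0 : ℝ) 1) : dirKernelZero l x y = dirKernel l x y := by
  wlog hxy : x ≤ y generalizing x y
  · rw [dirKernelZero_comm, dirKernel_comm]
    exact this hy hx (le_of_not_ge hxy)
  unfold dirKernelZero
  split_ifs with h
  · rfl
  · rw [dirKernel, if_pos hxy]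
    rcases hx.1.eq_or_lt with rfl | hx0
    · simp
    rcases hy.2.eq_or_lt with rfl | hy1
    · simp
    exact absurd ⟨⟨hx0, hxy.trans_lt hy1⟩, hx0.trans_le hxy, hy1⟩ h

/-- `G^λ(x,y) = Σ_{m=0}^∞ Σ_{w ∈ {1,2}^m} 2^{−m} Ψ^{λ/4^m}(F_w⁻¹x, F_w⁻¹y)`,
the series converging. -/
theorem dirKernel_eq_tsum (l : ℝ) (hl : 0 < l) (x y : ℝ)
    (hx : x ∈ Set.Icc (0:ℝ) 1) (hy : y ∈ Set.Icc (0:ℝ) 1) :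
    HasSum
      (fun m : ℕ => ∑ w : Fin m → Bool, (1 / 2 ^ m : ℝ) * PsiTerm l m (List.ofFn w) x y)
      (dirKernel l x y) := by
  rw [← dirKernelZero_eq_dirKernel l hx hy]
  refine (hasSum_iff_tendsto_nat_of_nonneg (levelSum_nonneg l x y) _).2 ?_
  refine tendsto_iff_norm_sub_tendsto_zero.2 (squeeze_zero (fun _ => norm_nonneg _)
    (g := fun N : ℕ => 2 * (1 / 2 : ℝ) ^ N) (fun N => ?_) ?_)
  · rw [Real.norm_eq_abs, abs_sub_comm]
    refine (abs_dirKernelZero_sub_sum_le N hl x y).trans ?_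
    split_ifs
    · rw [one_div, inv_pow, div_eq_mul_inv]
    · positivity
  · simpa using (tendsto_pow_atTop_nhds_zero_of_lt_one (r := (1 / 2 : ℝ)) (by norm_num)
      (by norm_num)).const_mul 2
end

section
/- For every λ > 0 and all x, y with 0 ≤ x ≤ y ≤ 1/2, the remainder R(x,y) := G^λ(x,y) − (sinh(√λ/2)/(2√λ·cosh(√λ/2)))·ψ^λ(x)·ψ^λ(y) satisfies R(x,y) = (1/2)·G^{λ/4}(2x, 2y); explicitly, R(x,y) = sinh(√λ·x)·sinh(√λ·(1/2 − y))/(√λ·sinh(√λ/2)). -/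
open Real Set

theorem dirKernel_remainder_eq {l x y : ℝ} (hl : 0 < l) (hxy : x ≤ y) (hy : y ≤ 1/2) :
    dirKernel l x y -
      (Real.sinh (Real.sqrt l / 2) / (2 * Real.sqrt l * Real.cosh (Real.sqrt l / 2))) *
        psiFun l x * psiFun l y
      = Real.sinh (Real.sqrt l * x) * Real.sinh (Real.sqrt l * (1/2 - y)) /
          (Real.sqrt l * Real.sinh (Real.sqrt l / 2)) := by
  rw [dirKernel, psiFun, psiFun, if_pos hxy, if_pos (hxy.trans hy), if_pos hy]
  have hs : 0 < Real.sqrt l := Real.sqrt_pos.2 hl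
  generalize Real.sqrt l = s at hs ⊢
  have hS : Real.sinh (s / 2) ≠ 0 := (Real.sinh_pos_iff.2 (half_pos hs)).ne'
  have hC : Real.cosh (s / 2) ≠ 0 := (Real.cosh_pos _).ne'
  have hdouble : Real.sinh s = 2 * Real.sinh (s / 2) * Real.cosh (s / 2) := by
    rw [← Real.sinh_two_mul, mul_div_cancel₀ s two_ne_zero]
  have hdiff : Real.sinh (s * (1 - y)) =
      Real.sinh (s * y) + 2 * Real.cosh (s / 2) * Real.sinh (s * (1/2 - y)) := by
    have h₁ : s * (1 - y) = s / 2 + s * (1/2 - y) := by ring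
    have h₂ : s * y = s / 2 - s * (1/2 - y) := by ring
    rw [h₁, h₂, Real.sinh_add, Real.sinh_sub]
    ring
  rw [hdouble, hdiff]
  field_simp
  ring

theorem half_mul_dirKernel_div_four {l x y : ℝ} (hxy : x ≤ y) :
    (1/2) * dirKernel (l/4) (2*x) (2*y)
      = Real.sinh (Real.sqrt l * x) * Real.sinh (Real.sqrt l * (1/2 - y)) /
          (Real.sqrt l * Real.sinh (Real.sqrt l / 2)) := by
  have hsqrt : Real.sqrt (l / 4) = Real.sqrt l / 2 := by
    rw [Real.sqrt_div' l (by norm_num), show (4 : ℝ) = 2 ^ 2 by norm_num,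
      Real.sqrt_sq zero_le_two]
  have hx : Real.sqrt l / 2 * (2 * x) = Real.sqrt l * x := by ring
  have hy : Real.sqrt l / 2 * (1 - 2 * y) = Real.sqrt l * (1/2 - y) := by ring
  rw [dirKernel, if_pos (by linarith), hsqrt, hx, hy]
  field_simp

/-- For `0 ≤ x ≤ y ≤ 1/2` the remainder `R(x,y) = G^λ(x,y) − Ψ^λ(x,y)` satisfies
`R(x,y) = (1/2)·G^{λ/4}(2x,2y) = sinh(√λ x)·sinh(√λ(1/2−y))/(√λ·sinh(√λ/2))`. -/
theorem dirKernel_remainder_scaling (l : ℝ) (hl : 0 < l) (x y : ℝ)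
    (hx0 : 0 ≤ x) (hxy : x ≤ y) (hy : y ≤ 1/2) :
    dirKernel l x y -
      (Real.sinh (Real.sqrt l / 2) / (2 * Real.sqrt l * Real.cosh (Real.sqrt l / 2))) *
        psiFun l x * psiFun l y
      = (1/2) * dirKernel (l/4) (2*x) (2*y) ∧
    dirKernel l x y -
      (Real.sinh (Real.sqrt l / 2) / (2 * Real.sqrt l * Real.cosh (Real.sqrt l / 2))) *
        psiFun l x * psiFun l y
      = Real.sinh (Real.sqrt l * x) * Real.sinh (Real.sqrt l * (1/2 - y)) /
          (Real.sqrt l * Real.sinh (Real.sqrt l / 2)) := by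
  have h := dirKernel_remainder_eq hl hxy hy
  exact ⟨h.trans (half_mul_dirKernel_div_four hxy).symm, h⟩
end

section
/- Let (λ_m)_{m≥0} be a real sequence with λ_{m−1} = λ_m·(5 − λ_m) for all m ≥ 1, such that λ_m ∉ {2, 5} for all m, λ_0 ≠ 0, and (3/2)·5^m·λ_m converges to a limit λ as m → ∞. Then the infinite product ∏_{j=2}^∞ (1 − λ_j/3) converges, and for α = (0,1,1)^T, lim_{k→∞} A_0^{−k} · A_0(λ_k)·A_0(λ_{k−1})⋯A_0(λ_1) · α = (4λ/(3·λ_0·(2 − λ_1))) · ∏_{j=2}^∞ (1 − λ_j/3) · α. -/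
open Matrix Filter Topology

/-- The harmonic extension matrix `A₀` of the Sierpinski gasket. -/
noncomputable def A0 : Matrix (Fin 3) (Fin 3) ℝ :=
  (1/5 : ℝ) • !![5, 0, 0; 2, 2, 1; 2, 1, 2]

/-- The eigenfunction extension matrix `A₀(μ)` of spectral decimation. -/
noncomputable def A0l (m : ℝ) : Matrix (Fin 3) (Fin 3) ℝ :=
  (1/((5 - m) * (2 - m))) •
    !![(5 - m) * (2 - m), 0, 0; 4 - m, 4 - m, 2; 4 - m, 2, 4 - m]

/-- The product `A₀(λ_k)·A₀(λ_{k−1})⋯A₀(λ_1)`. -/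
noncomputable def prodA (lam : ℕ → ℝ) : ℕ → Matrix (Fin 3) (Fin 3) ℝ
  | 0 => 1
  | k + 1 => A0l (lam (k + 1)) * prodA lam k

lemma A0_inv_mulVec : A0⁻¹ *ᵥ ![0, 1, 1] = (5 / 3 : ℝ) • ![0, 1, 1] := by
  have hdet : IsUnit A0.det := by
    rw [isUnit_iff_ne_zero]
    simp [A0, det_fin_three]
    norm_num
  have hA : A0 *ᵥ ((5 / 3 : ℝ) • ![0, 1, 1]) = ![0, 1, 1] := by
    ext i
    fin_cases i <;> simp [A0, mulVec, dotProduct, Fin.sum_univ_three] <;> norm_num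
  conv_lhs => rw [← hA]
  rw [mulVec_mulVec, nonsing_inv_mul _ hdet, one_mulVec]

lemma A0_inv_pow_mulVec (k : ℕ) :
    (A0⁻¹ ^ k) *ᵥ ![0, 1, 1] = ((5 / 3 : ℝ) ^ k) • ![0, 1, 1] := by
  induction k with
  | zero => simp
  | succ k ih =>
    rw [pow_succ, ← mulVec_mulVec, A0_inv_mulVec, mulVec_smul, ih, smul_smul, pow_succ']

lemma A0l_mulVec (m : ℝ) :
    A0l m *ᵥ ![0, 1, 1] = ((6 - m) / ((5 - m) * (2 - m))) • ![0, 1, 1] := by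
  rw [A0l, smul_mulVec, div_eq_mul_one_div (6 - m), mul_comm (6 - m), ← smul_smul]
  congr 1
  ext i
  fin_cases i <;> simp [mulVec, dotProduct, Fin.sum_univ_three] <;> ring

/-- The factors telescope, because `6 - λ_j = (2 - λ_{j+1}) (3 - λ_{j+1})`. -/
lemma prodA_mulVec (lam : ℕ → ℝ)
    (hrec : ∀ m : ℕ, lam m = lam (m + 1) * (5 - lam (m + 1)))
    (h25 : ∀ m : ℕ, lam m ≠ 2 ∧ lam m ≠ 5) (h0 : lam 0 ≠ 0) (k : ℕ) :
    prodA lam k *ᵥ ![0, 1, 1] =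
      (3 ^ k * lam k / lam 0 * ((2 - lam (k + 1)) / (2 - lam 1)) *
        ∏ j ∈ Finset.range k, (1 - lam (j + 2) / 3)) • ![0, 1, 1] := by
  have h2 (m : ℕ) : 2 - lam m ≠ 0 := sub_ne_zero.mpr (h25 m).1.symm
  have h5 (m : ℕ) : 5 - lam m ≠ 0 := sub_ne_zero.mpr (h25 m).2.symm
  induction k with
  | zero => simp [prodA, div_self h0, div_self (h2 1)]
  | succ k ih =>
    rw [prodA, ← mulVec_mulVec, ih, mulVec_smul, A0l_mulVec, smul_smul, Finset.prod_range_succ]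
    congr 1
    have h6 : 6 - lam (k + 1) = (2 - lam (k + 2)) * (3 - lam (k + 2)) := by
      rw [hrec (k + 1)]
      ring
    rw [h6, hrec k]
    have h2k := h2 (k + 1)
    have h5k := h5 (k + 1)
    have h21 := h2 1
    field_simp
    ring

lemma summable_of_tendsto_pow_mul (lam : ℕ → ℝ) (L : ℝ)
    (hlim : Tendsto (fun m : ℕ => (3/2 : ℝ) * 5 ^ m * lam m) atTop (𝓝 L)) :
    Summable lam := by
  have hgeom : Summable (fun m : ℕ => (1 / 5 : ℝ) ^ m) :=
    summable_geometric_of_lt_one (by norm_num) (by norm_num)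
  refine summable_of_isBigO_nat hgeom ?_
  have h := (hlim.isBigO_one ℝ).mul (Asymptotics.isBigO_refl (fun m : ℕ => (1 / 5 : ℝ) ^ m) atTop)
  refine ((h.const_mul_left (2 / 3)).congr_left fun m => ?_).congr_right fun m => one_mul _
  rw [one_div, inv_pow]
  field_simp

theorem sg_spectral_decimation_limit_alpha
    (lam : ℕ → ℝ) (L : ℝ)
    (hrec : ∀ m : ℕ, lam m = lam (m + 1) * (5 - lam (m + 1)))
    (h25 : ∀ m : ℕ, lam m ≠ 2 ∧ lam m ≠ 5)
    (h0 : lam 0 ≠ 0)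
    (hlim : Tendsto (fun m : ℕ => (3/2 : ℝ) * 5 ^ m * lam m) atTop (𝓝 L)) :
    ∃ p : ℝ,
      Tendsto (fun n : ℕ => ∏ j ∈ Finset.Icc 2 n, (1 - lam j / 3)) atTop (𝓝 p) ∧
      Tendsto (fun k : ℕ => (A0⁻¹ ^ k * prodA lam k).mulVec ![0, 1, 1]) atTop
        (𝓝 ((4 * L / (3 * lam 0 * (2 - lam 1)) * p) • ![0, 1, 1])) := by
  have hsum := summable_of_tendsto_pow_mul lam L hlim
  have hmul : Multipliable (fun j : ℕ => 1 - lam (j + 2) / 3) := by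
    have hs : Summable (fun j : ℕ => -(lam (j + 2) / 3)) :=
      (((summable_nat_add_iff 2).mpr hsum).div_const 3).neg
    simpa [sub_eq_add_neg] using Real.multipliable_one_add_of_summable hs
  have hprod := hmul.hasProd.tendsto_prod_nat
  refine ⟨∏' j : ℕ, (1 - lam (j + 2) / 3), ?_, ?_⟩
  · rw [← tendsto_add_atTop_iff_nat 1]
    refine hprod.congr fun n => ?_
    rw [← Finset.Ico_add_one_right_eq_Icc, Finset.prod_Ico_eq_prod_range]
    rw [show n + 1 + 1 - 2 = n by omega]
    simp only [add_comm 2]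
  · have hzero : Tendsto (fun k => lam (k + 1)) atTop (𝓝 0) :=
      (tendsto_add_atTop_iff_nat 1).mpr hsum.tendsto_atTop_zero
    have h := (((hlim.const_mul (2 / 3)).div_const (lam 0)).mul
      ((hzero.const_sub 2).div_const (2 - lam 1))).mul hprod
    have hcoef : 4 * L / (3 * lam 0 * (2 - lam 1)) * ∏' j : ℕ, (1 - lam (j + 2) / 3) =
        2 / 3 * L / lam 0 * ((2 - 0) / (2 - lam 1)) * ∏' j : ℕ, (1 - lam (j + 2) / 3) := by
      have h2 : 2 - lam 1 ≠ 0 := sub_ne_zero.mpr (h25 1).1.symm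
      field_simp
      ring
    rw [hcoef]
    refine (h.smul_const ![0, 1, 1]).congr fun k => ?_
    rw [← mulVec_mulVec, prodA_mulVec lam hrec h25 h0, mulVec_smul, A0_inv_pow_mulVec, smul_smul]
    congr 1
    rw [div_pow]
    field_simp
end

section
/- Let (λ_m)_{m≥0} be a real sequence with λ_{m−1} = λ_m·(5 − λ_m) for all m ≥ 1, such that λ_m ∉ {2, 5} for all m, λ_0 ≠ 0, and (3/2)·5^m·λ_m converges to a limit λ as m → ∞. Then for β = (0,1,−1)^T, lim_{k→∞} A_0^{−k} · A_0(λ_k)·A_0(λ_{k−1})⋯A_0(λ_1) · β = (2λ/(3·λ_0)) · β. -/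
open Matrix Filter Topology

theorem A0_inv_mulVec_beta : A0⁻¹ *ᵥ ![0, 1, -1] = (5 : ℝ) • ![0, 1, -1] := by
  have hdet : IsUnit A0.det := by
    rw [isUnit_iff_ne_zero, A0, det_smul, det_fin_three]
    simp
    norm_num
  have hA : A0 *ᵥ ((5 : ℝ) • ![0, 1, -1]) = ![0, 1, -1] := by
    ext i
    fin_cases i <;> simp [A0, mulVec, dotProduct, Fin.sum_univ_three] <;> norm_num
  conv_lhs => rw [← hA]
  rw [mulVec_mulVec, nonsing_inv_mul _ hdet, one_mulVec]

theorem A0_inv_pow_mulVec_beta (k : ℕ) :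
    (A0⁻¹ ^ k) *ᵥ ![0, 1, -1] = (5 : ℝ) ^ k • ![0, 1, -1] := by
  induction k with
  | zero => simp
  | succ k ih =>
    rw [pow_succ, ← mulVec_mulVec, A0_inv_mulVec_beta, mulVec_smul, ih, smul_smul, pow_succ']

theorem A0l_mulVec_beta {m : ℝ} (h2 : m ≠ 2) (h5 : m ≠ 5) :
    A0l m *ᵥ ![0, 1, -1] = (1 / (5 - m)) • ![0, 1, -1] := by
  have h2' : 2 - m ≠ 0 := sub_ne_zero.mpr h2.symm
  have h5' : 5 - m ≠ 0 := sub_ne_zero.mpr h5.symm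
  ext i
  fin_cases i <;> simp [A0l, mulVec, dotProduct, Fin.sum_univ_three] <;> field_simp <;> ring

theorem prodA_mulVec_beta {lam : ℕ → ℝ}
    (hrec : ∀ m : ℕ, lam m = lam (m + 1) * (5 - lam (m + 1)))
    (h25 : ∀ m : ℕ, lam m ≠ 2 ∧ lam m ≠ 5) (h0 : lam 0 ≠ 0) (k : ℕ) :
    prodA lam k *ᵥ ![0, 1, -1] = (lam k / lam 0) • ![0, 1, -1] := by
  induction k with
  | zero => simp [prodA, h0]
  | succ k ih =>
    have h5 : 5 - lam (k + 1) ≠ 0 := sub_ne_zero.mpr (h25 (k + 1)).2.symm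
    rw [prodA, ← mulVec_mulVec, ih, mulVec_smul,
      A0l_mulVec_beta (h25 (k + 1)).1 (h25 (k + 1)).2, smul_smul, hrec k]
    congr 1
    field_simp

theorem sg_spectral_decimation_limit_beta
    (lam : ℕ → ℝ) (L : ℝ)
    (hrec : ∀ m : ℕ, lam m = lam (m + 1) * (5 - lam (m + 1)))
    (h25 : ∀ m : ℕ, lam m ≠ 2 ∧ lam m ≠ 5)
    (h0 : lam 0 ≠ 0)
    (hlim : Tendsto (fun m : ℕ => (3/2 : ℝ) * 5 ^ m * lam m) atTop (𝓝 L)) :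
    Tendsto (fun k : ℕ => (A0⁻¹ ^ k * prodA lam k).mulVec ![0, 1, -1]) atTop
      (𝓝 ((2 * L / (3 * lam 0)) • ![0, 1, -1])) := by
  have hprod (k : ℕ) : (A0⁻¹ ^ k * prodA lam k) *ᵥ ![0, 1, -1] =
      (2 / (3 * lam 0) * ((3 / 2 : ℝ) * 5 ^ k * lam k)) • ![0, 1, -1] := by
    rw [← mulVec_mulVec, prodA_mulVec_beta hrec h25 h0, mulVec_smul, A0_inv_pow_mulVec_beta,
      smul_smul]
    congr 1
    field_simp
  simp only [hprod]
  rw [mul_div_right_comm]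
  exact (hlim.const_mul _).smul_const _
end

section
/- Let (λ_m)_{m≥0} be a real sequence with λ_{m−1} = λ_m·(5 − λ_m) for all m ≥ 1, such that λ_m ∉ {2, 5} for all m, λ_0 ≠ 0, and (3/2)·5^m·λ_m converges to a limit λ as m → ∞. Then lim_{m→∞} (2,−1,−1) · A_0^{−m} · A_0(λ_m)·A_0(λ_{m−1})⋯A_0(λ_1) · (1,0,0)^T = (2·(4 − λ_0)·λ/(3·λ_0·(2 − λ_1))) · ∏_{j=2}^∞ (1 − λ_j/3). (This is the normal derivative at q_0 of the λ-eigenfunction on the Sierpinski gasket with boundary values (1,0,0).) -/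
open Matrix Filter Topology

theorem A0_det_ne_zero : A0.det ≠ 0 := by
  simp [A0, Matrix.det_fin_three]
  norm_num

theorem vecMul_A0 : ![2, -1, -1] ᵥ* A0 = (3 / 5 : ℝ) • ![2, -1, -1] := by
  ext i
  fin_cases i <;> simp [A0, Matrix.vecMul, dotProduct, Fin.sum_univ_three] <;> norm_num

theorem vecMul_A0_inv : ![2, -1, -1] ᵥ* A0⁻¹ = (5 / 3 : ℝ) • ![2, -1, -1] := by
  have h : (![2, -1, -1] : Fin 3 → ℝ) = (5 / 3 : ℝ) • ![2, -1, -1] ᵥ* A0 := by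
    rw [vecMul_A0, smul_smul]
    norm_num
  conv_lhs => rw [h]
  rw [Matrix.smul_vecMul, Matrix.vecMul_vecMul,
    Matrix.mul_nonsing_inv _ (isUnit_iff_ne_zero.mpr A0_det_ne_zero), Matrix.vecMul_one]

theorem vecMul_A0_inv_pow (m : ℕ) :
    ![2, -1, -1] ᵥ* A0⁻¹ ^ m = (5 / 3 : ℝ) ^ m • ![2, -1, -1] := by
  induction m with
  | zero => simp
  | succ m ih =>
    rw [pow_succ, ← Matrix.vecMul_vecMul, ih, Matrix.smul_vecMul, vecMul_A0_inv, smul_smul,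
      pow_succ]

/-- The value at the two vertices other than `q₀` of the `m`-th cell containing `q₀`. -/
noncomputable def cellValue (lam : ℕ → ℝ) : ℕ → ℝ
  | 0 => 0
  | m + 1 => ((4 - lam (m + 1)) + (6 - lam (m + 1)) * cellValue lam m) /
      ((5 - lam (m + 1)) * (2 - lam (m + 1)))

theorem prodA_mulVec_s9 (lam : ℕ → ℝ) (h25 : ∀ m, lam m ≠ 2 ∧ lam m ≠ 5) (m : ℕ) :
    (prodA lam m).mulVec ![1, 0, 0] = ![1, cellValue lam m, cellValue lam m] := by
  induction m with
  | zero => simp [prodA, cellValue]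
  | succ m ih =>
    have h2 := sub_ne_zero.mpr (h25 (m + 1)).1.symm
    have h5 := sub_ne_zero.mpr (h25 (m + 1)).2.symm
    rw [prodA, ← Matrix.mulVec_mulVec, ih]
    ext i
    fin_cases i <;>
      simp [A0l, cellValue, Matrix.mulVec, dotProduct, Fin.sum_univ_three] <;>
      field_simp <;> ring

theorem normalDerivative_approx (lam : ℕ → ℝ) (h25 : ∀ m, lam m ≠ 2 ∧ lam m ≠ 5) (m : ℕ) :
    ![2, -1, -1] ⬝ᵥ (A0⁻¹ ^ m * prodA lam m).mulVec ![1, 0, 0] =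
      (5 / 3) ^ m * (2 * (1 - cellValue lam m)) := by
  rw [← Matrix.mulVec_mulVec, prodA_mulVec_s9 lam h25, Matrix.dotProduct_mulVec, vecMul_A0_inv_pow]
  simp [dotProduct, Fin.sum_univ_three]
  ring

theorem lam_ne_zero (lam : ℕ → ℝ) (hrec : ∀ m, lam m = lam (m + 1) * (5 - lam (m + 1)))
    (h0 : lam 0 ≠ 0) (m : ℕ) : lam m ≠ 0 := by
  induction m with
  | zero => exact h0
  | succ m ih => exact fun h => ih (by rw [hrec m, h, zero_mul])

theorem one_sub_cellValue_succ (lam : ℕ → ℝ)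
    (hrec : ∀ m, lam m = lam (m + 1) * (5 - lam (m + 1)))
    (h25 : ∀ m, lam m ≠ 2 ∧ lam m ≠ 5) (m : ℕ) :
    1 - cellValue lam (m + 1) - lam (m + 1) / 4 =
      (6 - lam (m + 1)) / ((5 - lam (m + 1)) * (2 - lam (m + 1))) *
        (1 - cellValue lam m - lam m / 4) := by
  have h2 := sub_ne_zero.mpr (h25 (m + 1)).1.symm
  have h5 := sub_ne_zero.mpr (h25 (m + 1)).2.symm
  rw [cellValue, hrec m]
  field_simp
  ring

theorem one_sub_cellValue_eq (lam : ℕ → ℝ)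
    (hrec : ∀ m, lam m = lam (m + 1) * (5 - lam (m + 1)))
    (h25 : ∀ m, lam m ≠ 2 ∧ lam m ≠ 5) (h0 : lam 0 ≠ 0) (m : ℕ) :
    1 - cellValue lam (m + 1) - lam (m + 1) / 4 =
      (4 - lam 0) / (4 * lam 0 * (2 - lam 1)) * lam (m + 1) * (6 - lam (m + 1)) * 3 ^ m *
        ∏ j ∈ Finset.range m, (1 - lam (j + 2) / 3) := by
  induction m with
  | zero =>
    have h2 := sub_ne_zero.mpr (h25 1).1.symm
    have h5 := sub_ne_zero.mpr (h25 1).2.symm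
    have h1 := lam_ne_zero lam hrec h0 1
    rw [one_sub_cellValue_succ lam hrec h25]
    simp only [cellValue, zero_add, hrec 0, Finset.range_zero, Finset.prod_empty]
    field_simp
    ring
  | succ m ih =>
    have h2 := sub_ne_zero.mpr (h25 (m + 2)).1.symm
    have h5 := sub_ne_zero.mpr (h25 (m + 2)).2.symm
    rw [one_sub_cellValue_succ lam hrec h25, ih, Finset.prod_range_succ, hrec (m + 1)]
    generalize (4 - lam 0) / (4 * lam 0 * (2 - lam 1)) = c
    generalize ∏ j ∈ Finset.range m, (1 - lam (j + 2) / 3) = P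
    simp only [add_assoc, Nat.reduceAdd]
    field_simp
    ring

theorem summable_lam (lam : ℕ → ℝ) (L : ℝ)
    (hlim : Tendsto (fun m : ℕ => (3 / 2 : ℝ) * 5 ^ m * lam m) atTop (𝓝 L)) : Summable lam := by
  refine summable_of_isBigO_nat (g := fun m => (2 / 3 : ℝ) * (1 / 5) ^ m)
    ((summable_geometric_of_lt_one (by norm_num) (by norm_num)).mul_left _) ?_
  refine ((hlim.isBigO_one ℝ).mul (Asymptotics.isBigO_refl
    (fun m : ℕ => (2 / 3 : ℝ) * (1 / 5) ^ m) atTop)).congr (fun m => ?_) (fun m => one_mul _)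
  rw [one_div, inv_pow]
  field_simp

theorem exists_tendsto_prod (lam : ℕ → ℝ) (hs : Summable lam) :
    ∃ p : ℝ, Tendsto (fun n : ℕ => ∏ j ∈ Finset.range n, (1 - lam (j + 2) / 3)) atTop (𝓝 p) := by
  have h : Summable fun j => -(lam (j + 2) / 3) :=
    (((summable_nat_add_iff 2).mpr hs).div_const 3).neg
  exact ⟨_, by simpa only [← sub_eq_add_neg] using
    (Real.multipliable_one_add_of_summable h).hasProd.tendsto_prod_nat⟩

/-- The normal derivative at `q₀` of the `λ`-eigenfunction on the Sierpinski gasket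
with boundary values `(1,0,0)`. -/
theorem sg_normal_derivative_at_one
    (lam : ℕ → ℝ) (L : ℝ)
    (hrec : ∀ m : ℕ, lam m = lam (m + 1) * (5 - lam (m + 1)))
    (h25 : ∀ m : ℕ, lam m ≠ 2 ∧ lam m ≠ 5)
    (h0 : lam 0 ≠ 0)
    (hlim : Tendsto (fun m : ℕ => (3/2 : ℝ) * 5 ^ m * lam m) atTop (𝓝 L)) :
    ∃ p : ℝ,
      Tendsto (fun n : ℕ => ∏ j ∈ Finset.Icc 2 n, (1 - lam j / 3)) atTop (𝓝 p) ∧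
      Tendsto
        (fun m : ℕ => ![2, -1, -1] ⬝ᵥ (A0⁻¹ ^ m * prodA lam m).mulVec ![1, 0, 0]) atTop
        (𝓝 (2 * (4 - lam 0) * L / (3 * lam 0 * (2 - lam 1)) * p)) := by
  have hs := summable_lam lam L hlim
  obtain ⟨p, hp⟩ := exists_tendsto_prod lam hs
  refine ⟨p, ?_, ?_⟩
  · rw [← tendsto_add_atTop_iff_nat 1]
    refine hp.congr fun n => ?_
    rw [← Finset.Ico_add_one_right_eq_Icc, Finset.prod_Ico_eq_prod_range]
    exact Finset.prod_congr (by simp) fun j _ => by rw [add_comm]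
  · rw [← tendsto_add_atTop_iff_nat 1]
    have hl := (tendsto_add_atTop_iff_nat 1).mpr hlim
    have hz := (tendsto_add_atTop_iff_nat 1).mpr hs.tendsto_atTop_zero
    have h3 : Tendsto (fun m : ℕ => (1 / 3 : ℝ) ^ (m + 1)) atTop (𝓝 0) :=
      (tendsto_add_atTop_iff_nat 1).mpr
        (tendsto_pow_atTop_nhds_zero_of_lt_one (by norm_num) (by norm_num))
    have hlim' := ((hl.mul h3).mul_const (1 / 3)).add
      (((hl.const_mul (4 / 9 * ((4 - lam 0) / (4 * lam 0 * (2 - lam 1))))).mul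
        (hz.const_sub 6)).mul hp)
    have h2 := sub_ne_zero.mpr (h25 1).1.symm
    convert hlim' using 1
    · ext m
      rw [normalDerivative_approx lam h25,
        eq_add_of_sub_eq (one_sub_cellValue_eq lam hrec h25 h0 m), div_pow, div_pow, one_pow]
      generalize (4 - lam 0) / (4 * lam 0 * (2 - lam 1)) = c
      field_simp
      ring
    · congr 1
      field_simp
      ring
end

section
/- Let λ ∈ ℝ with φ(λ) := 3·(5−λ)·(3−λ)·(4−6λ+λ²) ≠ 0. Then the linear system (4−λ)x = 1 + x + y + w, (4−λ)y = x + z + w, (4−λ)z = y + z + w, (4−λ)w = (4/3)(x + y + z) in the real unknowns x, y, z, w has the unique solution x = (96 − 109λ + 33λ² − 3λ³)/φ(λ), y = (16 − 3λ)(3 − λ)/φ(λ), z = (36 − 7λ)/φ(λ), w = 4·(5 − λ)(3 − λ)/φ(λ). -/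
/-- The symmetric eigenfunction extension system on `SG₃` with boundary values `(1,0,0)`
has the unique solution `(α(λ), β(λ), γ(λ), ρ(λ))`. -/
theorem sg3_eigenfunction_extension_system (l : ℝ)
    (hphi : 3 * (5 - l) * (3 - l) * (4 - 6*l + l^2) ≠ 0) (x y z w : ℝ) :
    ((4 - l) * x = 1 + x + y + w ∧
     (4 - l) * y = x + z + w ∧
     (4 - l) * z = y + z + w ∧
     (4 - l) * w = 4/3 * (x + y + z)) ↔
    (x = (96 - 109*l + 33*l^2 - 3*l^3) / (3 * (5 - l) * (3 - l) * (4 - 6*l + l^2)) ∧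
     y = (16 - 3*l) * (3 - l) / (3 * (5 - l) * (3 - l) * (4 - 6*l + l^2)) ∧
     z = (36 - 7*l) / (3 * (5 - l) * (3 - l) * (4 - 6*l + l^2)) ∧
     w = 4 * (5 - l) * (3 - l) / (3 * (5 - l) * (3 - l) * (4 - 6*l + l^2))) := by
  constructor
  · rintro ⟨h1, h2, h3, h4⟩
    have hyw : (16 - 3*l) * w = 4 * (5 - l) * y := by
      linear_combination 3 * h4 - 4 * h2
    have hy2 : (5 - l) * ((2 - l) * y - w) = 1 := by
      linear_combination h1 + h3 + (3 - l) * h2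
    have hy : y * (3 * (5 - l) * (4 - 6*l + l^2)) = 16 - 3*l := by
      linear_combination (16 - 3*l) * hy2 + (5 - l) * hyw
    have hw : w * (3 * (5 - l) * (4 - 6*l + l^2)) = 4 * (5 - l) := by
      linear_combination 4 * (5 - l) * hy2 + (5 - l) * (2 - l) * hyw
    refine ⟨?_, ?_, ?_, ?_⟩ <;> rw [eq_div_iff hphi]
    · linear_combination 3 * (5 - l) * (4 - 6*l + l^2) * h1 + hy + hw
    · linear_combination (3 - l) * hy
    · linear_combination 3 * (5 - l) * (4 - 6*l + l^2) * h3 + hy + hw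
    · linear_combination (3 - l) * hw
  · rintro ⟨rfl, rfl, rfl, rfl⟩
    generalize hp : 3 * (5 - l) * (3 - l) * (4 - 6*l + l^2) = p at hphi ⊢
    refine ⟨?_, ?_, ?_, ?_⟩ <;> field_simp
    · rw [← hp]
      ring
    all_goals ring
end
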